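/- arXiv:math/9702233 — 3 statements merged into one kernel-verified Lean document; each statement's English description precedes it below -/
import Mathlib

section
/- Let G be a finite group, N a normal subgroup of G, and p a prime. Suppose that every member of cd(G|N') is divisible by p, where N' is the derived (commutator) subgroup of N. Then N has a normal p-complement, i.e., N has a normal subgroup of order coprime to p whose index in N is a power of p. -/
open CategoryTheory

/-- `cdOver G N` is `cd(G|N)`: the set of degrees `χ(1)` of irreducible complex characters
`χ` of `G` whose kernel does not contain `N`.  Irreducible characters are formalized as
characters of simple objects of `FDRep ℂ G`, and `χ(1)` is the dimension of the
corresponding representation. -/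
def cdOver (G : Type) [Group G] (N : Subgroup G) : Set ℕ :=
  { d | ∃ V : FDRep ℂ G, Simple V ∧ (¬ ∀ n ∈ N, V.character n = V.character 1) ∧
        d = Module.finrank ℂ V }

/-- The derived subgroup of `S`, viewed in `G`, is `⁅S, S⁆`. -/
theorem Subgroup.map_subtype_commutator_self {G : Type*} [Group G] (S : Subgroup G) :
    (_root_.commutator S).map S.subtype = ⁅S, S⁆ := by
  simp [_root_.commutator_def, map_commutator, ← MonoidHom.range_eq_map]

section Characters

/-- An irreducible representation gives a simple object of `FDRep`. -/
theorem FDRep.simple_of_isIrreducible {G V : Type} [Group G] [Finite G] [AddCommGroup V]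
    [Module ℂ V] [FiniteDimensional ℂ V] (ρ : Representation ℂ G V) [ρ.IsIrreducible] :
    Simple (FDRep.of ρ) := by
  classical
  have := Fintype.ofFinite G
  have : Invertible (Nat.card G : ℂ) := invertibleOfNonzero (by simp)
  have h1 := Representation.char_orthonormal (ρ := ρ) (σ := ρ)
  rw [if_pos ⟨Representation.Equiv.refl ρ⟩] at h1
  rw [FDRep.simple_iff_char_is_norm_one]
  have hcard : (Nat.card G : ℂ) ≠ 0 := by simp
  have h2 : ∑ g : G, ρ.character g * ρ.character g⁻¹ = Nat.card G := by
    rwa [inv_mul_eq_one₀ hcard, eq_comm] at h1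
  exact h2

/-- If a complex character is constant on a subgroup, the subgroup acts trivially. -/
theorem Representation.apply_eq_of_character_eq {G V : Type*} [Group G] [Finite G]
    [AddCommGroup V] [Module ℂ V] [FiniteDimensional ℂ V] (ρ : Representation ℂ G V)
    (K : Subgroup G) (h : ∀ n ∈ K, ρ.character n = ρ.character 1) :
    ∀ n ∈ K, ∀ v, ρ n v = v := by
  classical
  have := Fintype.ofFinite K
  have : Invertible (Nat.card K : ℂ) := invertibleOfNonzero (by simp)
  let σ : Representation ℂ K V := ρ.comp K.subtype
  have h1 := Representation.card_inv_mul_sum_char_eq_finrank σ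
  have h2 : ∀ k : K, σ.character k = (Module.finrank ℂ V : ℂ) := fun k ↦ by
    rw [← ρ.char_one, ← h k k.2]; rfl
  simp [h2] at h1
  have h3 : σ.invariants = ⊤ := Submodule.eq_top_of_finrank_eq h1.symm
  intro n hn v
  have : v ∈ σ.invariants := h3 ▸ Submodule.mem_top
  exact this ⟨n, hn⟩

/-- If `p` divides every degree in `cdOver G K` but not the dimension of a representation, then
`K` fixes a nonzero vector. -/
theorem Representation.exists_ne_zero_fixed {G : Type} [Group G] [Finite G] (K : Subgroup G)
    (p : ℕ) (h : ∀ d ∈ cdOver G K, p ∣ d) (n : ℕ) :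
    ∀ (V : Type) [AddCommGroup V] [Module ℂ V] [FiniteDimensional ℂ V]
    (ρ : Representation ℂ G V), Module.finrank ℂ V = n → ¬ p ∣ n →
    ∃ v : V, v ≠ 0 ∧ ∀ k ∈ K, ρ k v = v := by
  induction n using Nat.strong_induction_on with
  | _ n ih =>
  intro V _ _ _ ρ hn hpn
  have hV : Nontrivial V := Module.nontrivial_of_finrank_pos (R := ℂ) (by
    rw [hn]; exact Nat.pos_of_ne_zero (by rintro rfl; simp at hpn))
  by_cases hirr : ρ.IsIrreducible
  · obtain ⟨v, hv⟩ := exists_ne (0 : V)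
    refine ⟨v, hv, fun k hk ↦ ρ.apply_eq_of_character_eq K ?_ k hk v⟩
    by_contra hc
    exact hpn (hn ▸ h _ ⟨FDRep.of ρ, FDRep.simple_of_isIrreducible ρ, hc, rfl⟩)
  · have hnt : Nontrivial (Subrepresentation ρ) := ⟨⊥, ⊤, fun e ↦ by
      have := congrArg Subrepresentation.toSubmodule e
      exact bot_ne_top (α := Submodule ℂ V) this⟩
    obtain ⟨W, hW0, hW1⟩ : ∃ W : Subrepresentation ρ, W ≠ ⊥ ∧ W ≠ ⊤ := by
      by_contra! hc
      exact hirr ⟨fun W ↦ or_iff_not_imp_left.2 (hc W)⟩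
    obtain ⟨W', hc⟩ := exists_isCompl W
    have hc' : IsCompl W.toSubmodule W'.toSubmodule :=
      ⟨disjoint_iff.2 (congrArg Subrepresentation.toSubmodule hc.inf_eq_bot),
       codisjoint_iff.2 (congrArg Subrepresentation.toSubmodule hc.sup_eq_top)⟩
    have hsum := Submodule.finrank_add_eq_of_isCompl hc'
    have hp0 : ∀ U : Subrepresentation ρ, U ≠ ⊥ → 0 < Module.finrank ℂ U.toSubmodule := by
      intro U hU
      rw [Module.finrank_pos_iff, Submodule.nontrivial_iff_ne_bot]
      exact fun e ↦ hU (Subrepresentation.toSubmodule_injective e)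
    have h1 := hp0 W hW0
    have h2 := hp0 W' (by rintro rfl; exact hW1 (eq_top_of_isCompl_bot hc))
    have key : ∀ U : Subrepresentation ρ, Module.finrank ℂ U.toSubmodule < n →
        ¬ p ∣ Module.finrank ℂ U.toSubmodule → ∃ v : V, v ≠ 0 ∧ ∀ k ∈ K, ρ k v = v := by
      intro U hU hpU
      obtain ⟨v, hv, hk⟩ := ih _ hU U.toSubmodule U.toRepresentation rfl hpU
      exact ⟨v, by simpa using hv, fun k hkK ↦ congrArg Subtype.val (hk k hkK)⟩
    by_cases hpW : p ∣ Module.finrank ℂ W.toSubmodule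
    · exact key W' (by omega) fun hpW' ↦ hpn (by
        rw [← hn, ← hsum]; exact dvd_add hpW hpW')
    · exact key W (by omega) hpW

/-- The functions on `G` transforming by `ψ` under right translation by `S`. -/
def coindSubmodule {G : Type*} [Group G] {S : Subgroup G} (ψ : S →* ℂˣ) :
    Submodule ℂ (G → ℂ) where
  carrier := {f | ∀ g (s : S), f (g * s) = ψ s * f g}
  add_mem' ha hb g s := by simp [ha g s, hb g s, mul_add]
  zero_mem' g s := by simp
  smul_mem' c f hf g s := by simp [hf g s]; ring

/-- The induced representation has dimension the index of `S`. -/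
theorem finrank_coindSubmodule {G : Type*} [Group G] [Finite G] {S : Subgroup G} (ψ : S →* ℂˣ) :
    Module.finrank ℂ (coindSubmodule ψ) = S.index := by
  classical
  have hS : ∀ g : G, ((g : G ⧸ S).out)⁻¹ * g ∈ S := fun g ↦
    QuotientGroup.eq.1 (QuotientGroup.out_eq' _)
  have := Fintype.ofFinite (G ⧸ S)
  let e : coindSubmodule ψ ≃ₗ[ℂ] (G ⧸ S → ℂ) :=
    { toFun f q := f.1 q.out
      map_add' _ _ := rfl
      map_smul' _ _ := rfl
      invFun c := ⟨fun g ↦ ψ ⟨_, hS g⟩ * c g, fun g s ↦ by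
        have h1 : ((g * s : G) : G ⧸ S) = g := by simp
        have h2 : (⟨_, hS (g * s)⟩ : S) = ⟨_, hS g⟩ * s := by
          ext; simp [mul_assoc]
        beta_reduce
        rw [h2, h1, map_mul]; push_cast; ring⟩
      left_inv f := by
        ext g
        simpa using (f.2 (g : G ⧸ S).out ⟨_, hS g⟩).symm
      right_inv c := by
        ext q
        have h2 : (⟨_, hS q.out⟩ : S) = 1 := by ext; simp
        simp only [h2]; simp }
  rw [e.finrank_eq, Module.finrank_fintype_fun_eq_card, Subgroup.index, Nat.card_eq_fintype_card]

/-- The left translation action on `coindSubmodule ψ`. -/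
def coindRepresentation {G : Type*} [Group G] {S : Subgroup G} (ψ : S →* ℂˣ) :
    Representation ℂ G (coindSubmodule ψ) where
  toFun h :=
    { toFun f := ⟨fun g ↦ f.1 (h⁻¹ * g), fun g s ↦ by
      beta_reduce; rw [← mul_assoc]; exact f.2 _ s⟩
      map_add' _ _ := rfl
      map_smul' _ _ := rfl }
  map_one' := by ext; simp
  map_mul' a b := by ext; simp [mul_assoc]

/-- If `p` divides every degree in `cdOver G K`, then every subgroup `S` of index prime to `p`
meets `K` inside the derived subgroup of `S`. -/
theorem inf_le_commutator_of_dvd_cdOver {G : Type} [Group G] [Finite G] (K : Subgroup G)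
    [K.Normal] (p : ℕ) (h : ∀ d ∈ cdOver G K, p ∣ d) (S : Subgroup G) (hS : ¬ p ∣ S.index) :
    S ⊓ K ≤ ⁅S, S⁆ := by
  rintro x ⟨hxS, hxK⟩
  by_contra hx
  have hx' : Abelianization.of (⟨x, hxS⟩ : S) ≠ 1 := by
    intro e
    apply hx
    have : (⟨x, hxS⟩ : S) ∈ commutator S := by
      rw [← Abelianization.ker_of]; exact e
    exact S.map_subtype_commutator_self ▸ Subgroup.mem_map_of_mem S.subtype this
  obtain ⟨χ, hχ⟩ := CommGroup.exists_apply_ne_one_of_hasEnoughRootsOfUnity (Abelianization S) ℂ hx'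
  let ψ : S →* ℂˣ := χ.comp Abelianization.of
  obtain ⟨f, hf0, hf⟩ := Representation.exists_ne_zero_fixed K p h _ _ (coindRepresentation ψ)
    (finrank_coindSubmodule ψ) hS
  obtain ⟨g, hg⟩ : ∃ g, f.1 g ≠ 0 := by
    by_contra! hc
    exact hf0 (Subtype.ext (funext hc))
  apply hχ
  have h1 := f.2 g ⟨x, hxS⟩
  have h2 := congrFun (congrArg Subtype.val (hf (g * x⁻¹ * g⁻¹)
    (Subgroup.Normal.conj_mem ‹_› _ (K.inv_mem hxK) g))) g
  have h3 : (f.1 ((g * x⁻¹ * g⁻¹)⁻¹ * g)) = f.1 g := h2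
  rw [show (g * x⁻¹ * g⁻¹)⁻¹ * g = g * x by group] at h3
  rw [h3] at h1
  ext
  exact mul_right_cancel₀ hg (h1.symm.trans (one_mul _).symm)

end Characters

section Transfer

open Subgroup
open scoped Pointwise IsMulCommutative commutatorElement

/-- In a nilpotent group, `Q ≤ [Q, S]` forces `Q` to be trivial. -/
theorem Subgroup.eq_bot_of_le_commutator_top {S : Type*} [Group S] [Group.IsNilpotent S]
    {Q : Subgroup S} (h : Q ≤ ⁅Q, ⊤⁆) : Q = ⊥ := by
  have key : ∀ n, Q ≤ (⊤ : Subgroup S).lowerCentralSeries n := by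
    intro n
    induction n with
    | zero => simp
    | succ n ih => exact h.trans (commutator_mono ih le_top)
  obtain ⟨n, hn⟩ := (isNilpotent_iff_lowerCentralSeries (⊤ : Subgroup S)).1 inferInstance
  exact le_bot_iff.1 (hn ▸ key n)

/-- A form of Tate's theorem: if `M` is the least normal subgroup of `p`-power index in `H` and
a Sylow subgroup `S` satisfies `S ∩ M ≤ S'`, then `S ∩ M = 1`. The transfer is applied to the
pullback of `H → H ⧸ M ← S ⧸ R`, where `R = [S ∩ M, S]`. -/
theorem IsPGroup.inf_eq_bot_of_inf_le_commutator {H : Type*} [Group H] [Finite H] {p : ℕ}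
    [hp : Fact p.Prime] {S M : Subgroup H} [M.Normal] (hS : IsPGroup p S) (hSi : ¬ p ∣ S.index)
    (hMS : M ⊔ S = ⊤)
    (hMmin : ∀ K : Subgroup H, K.Normal → K ≤ M → (∃ k, K.relIndex M = p ^ k) → K = M)
    (hSM : S ⊓ M ≤ ⁅S, S⁆) : S ⊓ M = ⊥ := by
  classical
  let Q : Subgroup S := M.subgroupOf S
  let R : Subgroup S := ⁅Q, ⊤⁆
  have hRQ : R ≤ Q := commutator_le_left Q ⊤
  let α : S →* H ⧸ M := (QuotientGroup.mk' M).comp S.subtype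
  have hα : ∀ x : S, α x = 1 ↔ x ∈ Q := fun x ↦ by
    simp [α, Q, mem_subgroupOf]
  let β : S ⧸ R →* H ⧸ M := QuotientGroup.lift R α fun x hx ↦ (hα x).2 (hRQ hx)
  let π : S →* S ⧸ R := QuotientGroup.mk' R
  have hβ : ∀ x : S, β (π x) = α x := fun x ↦ rfl
  have hcent : ∀ x ∈ Q, π x ∈ center (S ⧸ R) := by
    intro x hx
    rw [mem_center_iff]
    intro y
    obtain ⟨y, rfl⟩ := QuotientGroup.mk'_surjective R y
    have : ⁅x, y⁆ ∈ R := commutator_mem_commutator hx (mem_top y)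
    have h1 : π ⁅x, y⁆ = 1 := (QuotientGroup.eq_one_iff _).2 this
    rw [map_commutatorElement, commutatorElement_eq_one_iff_mul_comm] at h1
    exact h1.symm
  have hcent' : ∀ (y : S ⧸ R) (s : S), β y = α s → y * (π s)⁻¹ ∈ center (S ⧸ R) := by
    intro y s hys
    obtain ⟨x, rfl⟩ := QuotientGroup.mk'_surjective R y
    rw [← map_inv, ← map_mul]
    refine hcent _ ((hα _).1 ?_)
    rw [map_mul, map_inv, ← hys]
    exact mul_inv_cancel _
  let E : Subgroup (H × (S ⧸ R)) :=
    MonoidHom.eqLocus ((QuotientGroup.mk' M).comp (MonoidHom.fst _ _))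
      (β.comp (MonoidHom.snd _ _))
  let f : E →* H := (MonoidHom.fst _ _).comp E.subtype
  have hE : ∀ e : E, β e.1.2 = (f e : H ⧸ M) := fun e ↦ e.2.symm
  let δ : S →* E := (S.subtype.prod π).codRestrict E fun x ↦ rfl
  let ι : M →* E := (M.subtype.prod 1).codRestrict E fun x ↦ by
    change ((x : H) : H ⧸ M) = β 1
    simp
  have hf : Function.Surjective f := by
    intro g
    obtain ⟨m, hm, s, hs, rfl⟩ := mem_sup_of_normal_left.1 (hMS ▸ mem_top g : g ∈ M ⊔ S)
    exact ⟨ι ⟨m, hm⟩ * δ ⟨s, hs⟩, rfl⟩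
  let T : Subgroup E := S.comap f
  have hT : T.index = S.index := index_comap_of_surjective S hf
  let φ : T →* center (S ⧸ R) :=
    { toFun t := ⟨t.1.1.2 * (π ⟨f t.1, t.2⟩)⁻¹, hcent' _ _ (hE t.1)⟩
      map_one' := by
        ext
        change 1 * (π 1)⁻¹ = 1
        simp
      map_mul' a b := by
        ext
        have h1 : (⟨f (a * b).1, (a * b).2⟩ : S) = ⟨f a.1, a.2⟩ * ⟨f b.1, b.2⟩ := rfl
        have h2 := mem_center_iff.1 (hcent' _ _ (hE b.1) : _ * (π ⟨f b.1, b.2⟩)⁻¹ ∈ _)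
          (π ⟨f a.1, a.2⟩)⁻¹
        simp only [h1, map_mul, mul_inv_rev]
        change a.1.1.2 * b.1.1.2 * _ = a.1.1.2 * _ * (b.1.1.2 * _)
        rw [mul_assoc a.1.1.2 (π ⟨f a.1, a.2⟩)⁻¹, h2]
        simp only [mul_assoc] }
  let τ : E →* center (S ⧸ R) := MonoidHom.transfer φ
  have hpR : IsPGroup p (S ⧸ R) := hS.to_quotient R
  have hpC : IsPGroup p (center (S ⧸ R)) := hpR.to_subgroup _
  have hι : ∀ m, τ (ι m) = 1 := by
    let K := (τ.comp ι).ker.map M.subtype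
    have hK : K = M := by
      refine hMmin K ⟨?_⟩ (map_subtype_le _) ?_
      · rintro _ ⟨m, hm, rfl⟩ g
        obtain ⟨e, rfl⟩ := hf g
        refine ⟨⟨f e * m * (f e)⁻¹, Normal.conj_mem ‹_› _ m.2 _⟩, ?_, rfl⟩
        have h1 : ι ⟨f e * m * (f e)⁻¹, Normal.conj_mem ‹_› _ m.2 _⟩ = e * ι m * e⁻¹ := by
          apply Subtype.ext
          apply Prod.ext
          · rfl
          · change (1 : S ⧸ R) = e.1.2 * 1 * (e.1.2)⁻¹
            simp
        have h2 : τ (ι m) = 1 := hm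
        change τ (ι _) = 1
        rw [h1, map_mul, map_mul, h2, map_inv, mul_one, mul_inv_cancel]
      · have h1 : K.relIndex M = (τ.comp ι).ker.index := by
          rw [relIndex, subgroupOf, comap_map_eq_self_of_injective M.subtype_injective]
        rw [h1, index_ker]
        exact IsPGroup.iff_card.1 (hpC.to_subgroup _)
    intro m
    have : (m : H) ∈ K := hK.ge m.2
    obtain ⟨m', hm', h⟩ := this
    rw [← Subtype.ext h]
    exact hm'
  have hQR : Q ≤ R := by
    intro q hq
    have hqM : (q : H) ∈ M := hq
    let z : E := ⟨(1, π q), by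
      change (1 : H ⧸ M) = β (π q)
      rw [hβ, (hα q).2 hq]⟩
    have hz : ∀ e : E, Commute e z := fun e ↦ by
      apply Subtype.ext
      apply Prod.ext
      · change e.1.1 * 1 = 1 * e.1.1
        simp
      · exact mem_center_iff.1 (hcent q hq) _
    have h1 : τ z = φ ⟨z ^ T.index, _⟩ := MonoidHom.transfer_eq_pow φ z fun k g _ ↦ by
      have : Commute g (z ^ k) := (hz g).pow_right k
      rw [mul_assoc, ← this.eq, inv_mul_cancel_left]
    have h2 : (τ z : S ⧸ R) = π q ^ S.index := by
      rw [h1]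
      change (π q) ^ T.index * (π ⟨1 ^ T.index, _⟩)⁻¹ = _
      have h0 : ∀ h, π ⟨1 ^ T.index, h⟩ = 1 := fun h ↦ by
        rw [← map_one π]; congr 1; ext; exact one_pow _
      refine (congrArg (fun x ↦ π q ^ T.index * x⁻¹) (h0 _)).trans ?_
      rw [inv_one, mul_one, hT]
    have h3 : δ q = ι ⟨q, hqM⟩ * z := by
      apply Subtype.ext
      apply Prod.ext
      · exact (mul_one _).symm
      · exact (one_mul _).symm
    have h4 : τ (δ q) = 1 := by
      have h5 : q ∈ commutator S := by
        have h6 : (q : H) ∈ ⁅S, S⁆ := hSM ⟨q.2, hqM⟩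
        rw [← S.map_subtype_commutator_self] at h6
        obtain ⟨q', hq', h8⟩ := h6
        rwa [← Subtype.ext h8]
      exact (Abelianization.commutator_subset_ker (τ.comp δ)) h5
    have h5 : π q ^ S.index = 1 := by
      rw [← h2, ← one_mul (τ z), ← hι ⟨q, hqM⟩, ← map_mul, ← h3, h4]; rfl
    have h6 : π q = 1 := by
      obtain ⟨k, hk⟩ := hpR (π q)
      have hc : (p ^ k).Coprime S.index :=
        Nat.Coprime.pow_left _ ((Nat.Prime.coprime_iff_not_dvd hp.out).2 hSi)
      exact orderOf_eq_one_iff.1 (Nat.eq_one_of_dvd_coprimes hc (orderOf_dvd_of_pow_eq_one hk)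
        (orderOf_dvd_of_pow_eq_one h5))
    exact (QuotientGroup.eq_one_iff _).1 h6
  have : Group.IsNilpotent S := hS.isNilpotent
  have hQ : Q = ⊥ := eq_bot_of_le_commutator_top hQR
  rw [subgroupOf_eq_bot, disjoint_iff] at hQ
  rw [inf_comm, hQ]

/-- If `H = NS` with `S` a Sylow `p`-subgroup such that `S ∩ N' ≤ S'`, then `H` has a normal
`p`-complement contained in `N`. -/
theorem IsPGroup.exists_normal_isComplement {H : Type*} [Group H] [Finite H] {p : ℕ}
    [hp : Fact p.Prime] {S N : Subgroup H} [N.Normal] (hS : IsPGroup p S) (hSi : ¬ p ∣ S.index)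
    (hNS : N ⊔ S = ⊤) (hSN : S ⊓ ⁅N, N⁆ ≤ ⁅S, S⁆) :
    ∃ M : Subgroup H, M.Normal ∧ M ≤ N ∧ (Nat.card M).Coprime p ∧
      ∃ k : ℕ, M.index = p ^ k := by
  classical
  obtain ⟨a, ha⟩ := IsPGroup.iff_card.1 hS
  let A : Set (Subgroup H) := {K | K.Normal ∧ ∃ k, K.index = p ^ k}
  have hA : ∀ K ∈ A, ∀ L ∈ A, K ⊓ L ∈ A := by
    rintro K ⟨hK, k, hk⟩ L ⟨hL, l, hl⟩
    refine ⟨inferInstance, ?_⟩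
    obtain ⟨j, -, hj⟩ := (Nat.dvd_prime_pow hp.out).1 (hk ▸ relIndex_dvd_index_of_normal K L)
    refine ⟨j + l, ?_⟩
    rw [← relIndex_mul_index (inf_le_right : K ⊓ L ≤ L), inf_relIndex_right, hj, hl, pow_add]
  obtain ⟨M, hMA, hMmin⟩ := (Set.toFinite A).exists_minimal ⟨⊤, inferInstance, 0, by simp⟩
  have hMle : ∀ K ∈ A, M ≤ K := fun K hK ↦
    (hMmin (hA M hMA K hK) inf_le_left).trans inf_le_right
  obtain ⟨hMn, k, hk⟩ := id hMA
  have hNA : N ∈ A := by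
    refine ⟨‹_›, ?_⟩
    have h1 : N.index = N.relIndex S := by
      rw [← relIndex_top_right, ← hNS, sup_comm, relIndex_sup_right]
    have h2 : N.index ∣ p ^ a := by
      rw [h1, ← ha]; exact relIndex_dvd_card N S
    obtain ⟨j, -, hj⟩ := (Nat.dvd_prime_pow hp.out).1 h2
    exact ⟨j, hj⟩
  obtain ⟨j, hj⟩ := hNA.2
  have hc : (p ^ k).Coprime S.index :=
    Nat.Coprime.pow_left _ ((Nat.Prime.coprime_iff_not_dvd hp.out).2 hSi)
  have hMS : M ⊔ S = ⊤ := by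
    rw [← index_eq_one]
    exact Nat.eq_one_of_dvd_coprimes hc (hk ▸ index_dvd_of_le le_sup_left)
      (index_dvd_of_le le_sup_right)
  have hSM : S ⊓ M ≤ ⁅S, S⁆ := by
    let f : N →* Abelianization N := (powMonoidHom S.index).comp Abelianization.of
    let L := f.ker.map N.subtype
    have hNN : (commutator N).map N.subtype = ⁅N, N⁆ := by
      simp [commutator_def, map_commutator, ← MonoidHom.range_eq_map]
    have hL : ∀ x, x ∈ L ↔ x ∈ N ∧ x ^ S.index ∈ ⁅N, N⁆ := by
      have h1 : ∀ y : N, y ∈ f.ker ↔ (y : H) ^ S.index ∈ ⁅N, N⁆ := by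
        intro y
        have h2 : f y = Abelianization.of (y ^ S.index) := by simp [f]
        rw [MonoidHom.mem_ker, h2, ← MonoidHom.mem_ker, Abelianization.ker_of,
          ← N.map_subtype_commutator_self]
        constructor
        · exact fun h ↦ ⟨_, h, rfl⟩
        · rintro ⟨y', hy', h3⟩
          rwa [← (Subtype.ext h3 : y' = y ^ S.index)]
      intro x
      constructor
      · rintro ⟨y, hy, rfl⟩
        exact ⟨y.2, (h1 y).1 hy⟩
      · rintro ⟨hx, h⟩
        exact ⟨⟨x, hx⟩, (h1 ⟨x, hx⟩).2 h, rfl⟩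
    have hLA : L ∈ A := by
      refine ⟨⟨fun x hx g ↦ ?_⟩, ?_⟩
      · rw [hL] at hx ⊢
        rw [conj_pow]
        exact ⟨Normal.conj_mem ‹_› _ hx.1 g, Normal.conj_mem inferInstance _ hx.2 g⟩
      · have hr : IsPGroup p f.range := by
          rintro ⟨_, y, rfl⟩
          refine ⟨a, Subtype.ext ?_⟩
          have h2 : f y ^ p ^ a = Abelianization.of (y ^ (Nat.card S * S.index)) := by
            rw [map_pow, mul_comm, pow_mul, ha]; rfl
          have h3 : y ^ (Nat.card S * S.index) = 1 := by
            rw [card_mul_index]; ext; simp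
          change f y ^ p ^ a = 1
          rw [h2, h3, map_one]
        obtain ⟨i, hi⟩ := IsPGroup.iff_card.1 hr
        have h1 : L.relIndex N = p ^ i := by
          rw [relIndex, subgroupOf, comap_map_eq_self_of_injective N.subtype_injective,
            index_ker, hi]
        refine ⟨i + j, ?_⟩
        rw [← relIndex_mul_index (map_subtype_le _ : L ≤ N), h1, hj, pow_add]
    rintro x ⟨hxS, hxM⟩
    have h1 := ((hL x).1 (hMle L hLA hxM)).2
    have h2 : x ^ S.index ∈ ⁅S, S⁆ := hSN ⟨S.pow_mem hxS _, h1⟩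
    have h3 : (Nat.card S).Coprime S.index := by
      rw [ha]
      exact Nat.Coprime.pow_left _ ((Nat.Prime.coprime_iff_not_dvd hp.out).2 hSi)
    have h4 : x ∈ zpowers (x ^ S.index) := by
      have h5 : orderOf x ∣ Nat.card S := S.orderOf_dvd_natCard hxS
      obtain ⟨m, hm⟩ := exists_pow_eq_self_of_coprime (h3.symm.coprime_dvd_right h5)
      exact ⟨m, by simpa using hm⟩
    exact (zpowers_le.2 h2) h4
  have hbot := hS.inf_eq_bot_of_inf_le_commutator hSi hMS (fun K hK hKM ⟨i, hi⟩ ↦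
    le_antisymm hKM (hMle K ⟨hK, i + k, by
      rw [← relIndex_mul_index hKM, hi, hk, pow_add]⟩)) hSM
  have hcompl : IsComplement' M S := isComplement'_of_disjoint_and_mul_eq_univ
    (disjoint_iff.2 (by rw [inf_comm, hbot])) (by rw [← normal_mul, hMS]; rfl)
  refine ⟨M, hMn, hMle N hNA, ?_, k, hk⟩
  rw [← hcompl.index_eq_card]
  exact ((Nat.Prime.coprime_iff_not_dvd hp.out).2 hSi).symm

end Transfer

/-- **Theorem D (Berkovich).** If every member of `cd(G|N')` is divisible by the prime `p`,
where `N'` is the derived subgroup of the normal subgroup `N` of the finite group `G`,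
then `N` has a normal `p`-complement: a normal subgroup of `N` of order coprime to `p`
whose index in `N` is a power of `p`. -/
theorem stmt0 (G : Type) [Group G] [Fintype G] (N : Subgroup G) [N.Normal]
    (p : ℕ) (hp : p.Prime)
    (h : ∀ d ∈ cdOver G ⁅N, N⁆, p ∣ d) :
    ∃ M : Subgroup ↥N, M.Normal ∧ (Nat.card M).Coprime p ∧ ∃ k : ℕ, M.index = p ^ k := by
  have : Fact p.Prime := ⟨hp⟩
  obtain ⟨P⟩ : Nonempty (Sylow p G) := inferInstance
  let S : Subgroup G := P
  have hSi : ¬ p ∣ S.index := P.not_dvd_index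
  let H := N ⊔ S
  have hNH : N ≤ H := le_sup_left
  have hSH : S ≤ H := le_sup_right
  have hmap : ∀ K ≤ H, (K.subgroupOf H).map H.subtype = K := fun K hK ↦ by
    rw [Subgroup.subgroupOf_map_subtype, inf_eq_left.2 hK]
  obtain ⟨M, hM, hMN, hc, k, hk⟩ := IsPGroup.exists_normal_isComplement
    (S := S.subgroupOf H) (N := N.subgroupOf H) (p := p)
    (P.2.comap_of_injective H.subtype H.subtype_injective)
    (fun hd ↦ hSi (hd.trans (Subgroup.relIndex_dvd_index_of_le hSH)))
    (by rw [← Subgroup.subgroupOf_sup hNH hSH, Subgroup.subgroupOf_self])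
    (by
      rw [← Subgroup.map_le_map_iff_of_injective H.subtype_injective,
        Subgroup.map_inf _ _ _ H.subtype_injective,
        Subgroup.map_commutator, Subgroup.map_commutator, hmap N hNH, hmap S hSH]
      exact inf_le_commutator_of_dvd_cdOver ⁅N, N⁆ p h S hSi)
  have hM' : M.map H.subtype ≤ N := by
    rw [← hmap N hNH]
    exact Subgroup.map_mono hMN
  refine ⟨(M.map H.subtype).subgroupOf N, ⟨fun x hx g ↦ ?_⟩, ?_, ?_⟩
  · obtain ⟨y, hy, hxy⟩ := hx
    exact ⟨_, hM.conj_mem y hy ⟨g, hNH g.2⟩, by simp [show (y : G) = x from hxy]⟩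
  · rwa [Nat.card_congr (Subgroup.subgroupOfEquivOfLe hM').toEquiv,
      Subgroup.card_map_of_injective H.subtype_injective]
  · have h1 : (M.map H.subtype).relIndex N = M.relIndex (N.subgroupOf H) := by
      conv_lhs => rw [← hmap N hNH]
      rw [Subgroup.relIndex_map_map_of_injective _ _ H.subtype_injective]
    have h2 : (M.map H.subtype).relIndex N ∣ p ^ k := by
      rw [h1, ← hk]
      exact Subgroup.relIndex_dvd_index_of_normal _ _
    obtain ⟨j, -, hj⟩ := (Nat.dvd_prime_pow hp).1 h2
    exact ⟨j, hj⟩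
end

section
/- Let G be a finite group and N a normal subgroup of G with |cd(G|N)| ≤ 1. Then the derived length of N is at most |cd(G|N)|; in particular N is abelian. -/
open CategoryTheory

section

open Module

namespace Representation

variable {G : Type} [Group G]

/-- The dimensions of complementary subrepresentations add up to the dimension. -/
theorem finrank_add_finrank_of_isCompl {V : Type} [AddCommGroup V] [Module ℂ V]
    [FiniteDimensional ℂ V] {ρ : Representation ℂ G V} {p q : Subrepresentation ρ}
    (h : IsCompl p q) :
    finrank ℂ p.toSubmodule + finrank ℂ q.toSubmodule = finrank ℂ V := by
  refine Submodule.finrank_add_eq_of_isCompl ⟨?_, ?_⟩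
  · exact disjoint_iff.2 (congrArg Subrepresentation.toSubmodule h.inf_eq_bot)
  · exact codisjoint_iff.2 (congrArg Subrepresentation.toSubmodule h.sup_eq_top)

/-- Induction principle for finite-dimensional representations: by complete reducibility it
suffices to treat the zero representation, irreducible ones, and direct sums. -/
theorem induction_on_irreducible [Finite G]
    {P : ∀ {V : Type} [AddCommGroup V] [Module ℂ V], Representation ℂ G V → Prop}
    (zero : ∀ {V : Type} [AddCommGroup V] [Module ℂ V] [Subsingleton V]
      (ρ : Representation ℂ G V), P ρ)
    (irreducible : ∀ {V : Type} [AddCommGroup V] [Module ℂ V] [FiniteDimensional ℂ V]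
      (ρ : Representation ℂ G V), ρ.IsIrreducible → P ρ)
    (compl : ∀ {V : Type} [AddCommGroup V] [Module ℂ V] [FiniteDimensional ℂ V]
      (ρ : Representation ℂ G V) (p q : Subrepresentation ρ), IsCompl p q →
      P p.toRepresentation → P q.toRepresentation → P ρ)
    {V : Type} [AddCommGroup V] [Module ℂ V] [FiniteDimensional ℂ V]
    (ρ : Representation ℂ G V) : P ρ := by
  induction hd : finrank ℂ V using Nat.strong_induction_on generalizing V with
  | _ d ih =>
  subst hd
  rcases subsingleton_or_nontrivial V with hV | hV
  · exact zero ρ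
  by_cases hirr : ρ.IsIrreducible
  · exact irreducible ρ hirr
  have hnt : Nontrivial (Subrepresentation ρ) := by
    refine ⟨⊥, ⊤, fun h => ?_⟩
    exact bot_ne_top (α := Submodule ℂ V) (congrArg Subrepresentation.toSubmodule h)
  obtain ⟨p, hp⟩ : ∃ p : Subrepresentation ρ, ¬ (p = ⊥ ∨ p = ⊤) := by
    by_contra! h
    exact hirr ⟨h⟩
  rw [not_or] at hp
  obtain ⟨q, hpq⟩ := exists_isCompl p
  have hsum := finrank_add_finrank_of_isCompl hpq
  have key : ∀ r : Subrepresentation ρ, r ≠ ⊥ → 0 < finrank ℂ r.toSubmodule := by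
    intro r hr
    by_contra! h0
    have := Submodule.finrank_eq_zero.1 (Nat.le_zero.1 h0)
    exact hr (Subrepresentation.toSubmodule_injective this)
  have hq : q ≠ ⊥ := by
    rintro rfl
    exact hp.2 (by simpa using hpq.sup_eq_top)
  have h1 := key p hp.1
  have h2 := key q hq
  exact compl ρ p q hpq (ih _ (by omega) _ rfl) (ih _ (by omega) _ rfl)

/-- If every irreducible representation that is nontrivial on `N` has dimension `m`, then `m`
divides the dimension of every representation without nonzero `N`-fixed vectors. -/
theorem dvd_finrank_of_no_fixed [Finite G] {N : Subgroup G} {m : ℕ}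
    (H : ∀ {V : Type} [AddCommGroup V] [Module ℂ V] [FiniteDimensional ℂ V]
      (ρ : Representation ℂ G V), ρ.IsIrreducible → (∃ n ∈ N, ρ n ≠ 1) → finrank ℂ V = m)
    {V : Type} [AddCommGroup V] [Module ℂ V] [FiniteDimensional ℂ V]
    (ρ : Representation ℂ G V) (hρ : ∀ v, (∀ n ∈ N, ρ n v = v) → v = 0) :
    m ∣ finrank ℂ V := by
  induction ρ using induction_on_irreducible with
  | zero ρ => simp [finrank_zero_of_subsingleton]
  | @irreducible V _ _ _ ρ h =>
    rw [H ρ h]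
    by_contra! hn
    have : ∀ v : V, v = 0 := fun v => hρ v fun n hn' => by rw [hn n hn']; rfl
    obtain ⟨p, q, hpq⟩ := h.toNontrivial
    refine hpq (Subrepresentation.toSubmodule_injective ?_)
    ext v
    rw [this v]
    exact iff_of_true p.toSubmodule.zero_mem q.toSubmodule.zero_mem
  | compl ρ p q hpq hp hq =>
    rw [← finrank_add_finrank_of_isCompl hpq]
    refine dvd_add (hp fun v hv => ?_) (hq fun v hv => ?_)
    · exact Subtype.ext (hρ v fun n hn => congrArg Subtype.val (hv n hn))
    · exact Subtype.ext (hρ v fun n hn => congrArg Subtype.val (hv n hn))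

/-- The subrepresentation of vectors fixed by a normal subgroup. -/
def fixedBy {V : Type} [AddCommGroup V] [Module ℂ V] (ρ : Representation ℂ G V)
    (N : Subgroup G) [hN : N.Normal] : Subrepresentation ρ where
  toSubmodule :=
    { carrier := {v | ∀ n ∈ N, ρ n v = v}
      add_mem' := fun ha hb n hn => by rw [map_add, ha n hn, hb n hn]
      zero_mem' := fun n _ => map_zero _
      smul_mem' := fun c v hv n hn => by rw [map_smul, hv n hn] }
  apply_mem_toSubmodule g v hv n hn := by
    have h := hv (g⁻¹ * n * g) (by simpa using hN.conj_mem n hn g⁻¹)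
    rw [← Module.End.mul_apply, ← map_mul]
    conv_rhs => rw [← h]
    rw [← Module.End.mul_apply, ← map_mul]
    congr 2
    group

/-- If every irreducible representation that is nontrivial on `N` has dimension `m`, then the
dimension of a representation is that of its `N`-fixed vectors modulo `m`. -/
theorem exists_finrank_eq_finrank_fixedBy_add [Finite G] {N : Subgroup G} [N.Normal] {m : ℕ}
    (H : ∀ {V : Type} [AddCommGroup V] [Module ℂ V] [FiniteDimensional ℂ V]
      (ρ : Representation ℂ G V), ρ.IsIrreducible → (∃ n ∈ N, ρ n ≠ 1) → finrank ℂ V = m)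
    {V : Type} [AddCommGroup V] [Module ℂ V] [FiniteDimensional ℂ V]
    (ρ : Representation ℂ G V) :
    ∃ k, finrank ℂ V = finrank ℂ (ρ.fixedBy N).toSubmodule + m * k := by
  obtain ⟨q, hq⟩ := exists_isCompl (ρ.fixedBy N)
  obtain ⟨k, hk⟩ : m ∣ finrank ℂ q.toSubmodule := by
    refine dvd_finrank_of_no_fixed H q.toRepresentation fun v hv => ?_
    have h1 : (v : V) ∈ (ρ.fixedBy N ⊓ q).toSubmodule :=
      ⟨fun n hn => congrArg Subtype.val (hv n hn), v.2⟩
    rw [hq.inf_eq_bot] at h1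
    exact Subtype.ext ((Submodule.mem_bot ℂ).1 h1)
  exact ⟨k, by rw [← finrank_add_finrank_of_isCompl hq, hk]⟩

end Representation

/-- A nonzero central idempotent that is not a sum of two nonzero orthogonal central
idempotents. -/
structure IsPrimitiveCentralIdempotent {B : Type} [Ring B] (b : B) : Prop where
  ne_zero : b ≠ 0
  comm : ∀ c, c * b = b * c
  idem : b * b = b
  primitive : ∀ c : B, (∀ x, x * c = c * x) → c * c = c → c * b = 0 ∨ c * b = b

namespace IsPrimitiveCentralIdempotent

theorem map {B : Type} [Ring B] {b : B} (h : IsPrimitiveCentralIdempotent b) (ψ : B ≃+* B) :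
    IsPrimitiveCentralIdempotent (ψ b) where
  ne_zero := by simpa using h.ne_zero
  comm c := by
    obtain ⟨c, rfl⟩ := ψ.surjective c
    rw [← map_mul, h.comm, map_mul]
  idem := by rw [← map_mul, h.idem]
  primitive c hc hcc := by
    obtain ⟨c, rfl⟩ := ψ.surjective c
    have := h.primitive c (fun x => ψ.injective (by rw [map_mul, map_mul, hc]))
      (ψ.injective (by rw [map_mul, hcc]))
    refine this.imp (fun h => ?_) (fun h => ?_)
    · rw [← map_mul, h, map_zero]
    · rw [← map_mul, h]

end IsPrimitiveCentralIdempotent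

section PiMatrix

variable {t : ℕ} {d : Fin t → ℕ}

theorem Pi.matrix_central_iff [∀ i, NeZero (d i)] (b : ∀ i, Matrix (Fin (d i)) (Fin (d i)) ℂ) :
    (∀ c, c * b = b * c) ↔ ∃ x : Fin t → ℂ, b = fun i => Matrix.scalar (Fin (d i)) (x i) := by
  constructor
  · intro h
    have : ∀ i, b i ∈ Set.center (Matrix (Fin (d i)) (Fin (d i)) ℂ) := by
      intro i
      rw [Semigroup.mem_center_iff]
      intro c
      simpa using congrFun (h (Pi.single i c)) i
    simp only [Matrix.center_eq_range] at this
    choose x hx using this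
    exact ⟨x, funext fun i => (hx i).symm⟩
  · rintro ⟨x, rfl⟩ c
    funext i
    exact (Matrix.scalar_commute (x i) (fun r' => mul_comm _ _) (c i)).symm

theorem Pi.finrank_matrix_center [∀ i, NeZero (d i)] :
    finrank ℂ (Subalgebra.center ℂ (∀ i, Matrix (Fin (d i)) (Fin (d i)) ℂ)) = t := by
  let f : (Fin t → ℂ) →ₗ[ℂ] ∀ i, Matrix (Fin (d i)) (Fin (d i)) ℂ :=
    LinearMap.pi fun i => (Algebra.linearMap ℂ _).comp (LinearMap.proj i)
  have hf : LinearMap.range f = Subalgebra.toSubmodule (Subalgebra.center ℂ _) := by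
    ext b
    rw [Subalgebra.mem_toSubmodule, Subalgebra.mem_center_iff, Pi.matrix_central_iff]
    exact exists_congr fun x => eq_comm
  have hinj : Function.Injective f := by
    intro x y hxy
    funext i
    exact Matrix.scalar_inj.1 (congrFun hxy i)
  rw [← Subalgebra.finrank_toSubmodule, ← hf, LinearMap.finrank_range_of_inj hinj]
  simp

theorem Pi.isPrimitiveCentralIdempotent_single [∀ i, NeZero (d i)] (i : Fin t) :
    IsPrimitiveCentralIdempotent
      (Pi.single i 1 : ∀ i, Matrix (Fin (d i)) (Fin (d i)) ℂ) where
  ne_zero := by simp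
  comm c := by
    rw [← Pi.single_mul_left, ← Pi.single_mul_right]; simp
  idem := by rw [← Pi.single_mul]; simp
  primitive c hc hcc := by
    obtain ⟨x, rfl⟩ := (Pi.matrix_central_iff c).1 hc
    have h := congrFun hcc i
    have h2 : x i * x i = x i := by
      rw [Pi.mul_apply, ← map_mul] at h
      exact Matrix.scalar_inj.1 h
    rw [← Pi.single_mul_right]
    rcases IsIdempotentElem.iff_eq_zero_or_one.1 h2 with h0 | h1
    · left; simp [h0]
    · right; simp [h1]

theorem Pi.exists_map_single_one_eq [∀ i, NeZero (d i)]
    (ψ : (∀ i, Matrix (Fin (d i)) (Fin (d i)) ℂ) ≃ₐ[ℂ] ∀ i, Matrix (Fin (d i)) (Fin (d i)) ℂ)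
    (i : Fin t) : ∃ j, ψ (Pi.single i 1) = Pi.single j 1 ∧ d j = d i := by
  have h := (isPrimitiveCentralIdempotent_single (d := d) i).map (ψ : _ ≃+* _)
  obtain ⟨j, hj⟩ : ∃ j, ψ (Pi.single i 1) j ≠ 0 := by
    by_contra! h0
    exact h.ne_zero (funext h0)
  have hs := isPrimitiveCentralIdempotent_single (d := d) j
  have hne : ψ (Pi.single i 1) * Pi.single j 1 ≠ 0 := by
    rw [← Pi.single_mul_right]
    simpa using hj
  have h1 := (hs.primitive _ h.comm h.idem).resolve_left hne
  have h2 := (h.primitive _ hs.comm hs.idem).resolve_left (by rw [h.comm]; exact hne)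
  have h3 : ψ (Pi.single i 1) = Pi.single j 1 := by
    rw [← h1]; rw [h.comm] at h2; exact h2.symm
  have hr : ∀ k : Fin t, finrank ℂ (LinearMap.range (LinearMap.mulLeft ℂ
      (Pi.single k 1 : ∀ i, Matrix (Fin (d i)) (Fin (d i)) ℂ))) = d k ^ 2 := by
    intro k
    have : LinearMap.range (LinearMap.mulLeft ℂ
      (Pi.single k 1 : ∀ i, Matrix (Fin (d i)) (Fin (d i)) ℂ)) =
        LinearMap.range (LinearMap.single ℂ (fun i => Matrix (Fin (d i)) (Fin (d i)) ℂ) k) := by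
      ext b
      constructor
      · rintro ⟨b, rfl⟩
        exact ⟨b k, by simp [← Pi.single_mul_left]⟩
      · rintro ⟨b, rfl⟩
        exact ⟨Pi.single k b, by simp [← Pi.single_mul]⟩
    have hinj : Function.Injective
        (LinearMap.single ℂ (fun i => Matrix (Fin (d i)) (Fin (d i)) ℂ) k) :=
      fun _ _ h => Pi.single_injective k h
    rw [this, LinearMap.finrank_range_of_inj hinj, finrank_matrix]
    simp [sq]
  refine ⟨j, h3, ?_⟩
  have hm : (LinearMap.range (LinearMap.mulLeft ℂ
      (Pi.single i 1 : ∀ i, Matrix (Fin (d i)) (Fin (d i)) ℂ))).map ψ.toLinearEquiv.toLinearMap =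
      LinearMap.range (LinearMap.mulLeft ℂ (Pi.single j 1)) := by
    ext b
    simp only [Submodule.mem_map, LinearMap.mem_range, LinearMap.mulLeft_apply]
    constructor
    · rintro ⟨_, ⟨c, rfl⟩, rfl⟩
      exact ⟨ψ c, by simp [h3]⟩
    · rintro ⟨c, rfl⟩
      exact ⟨_, ⟨ψ.symm c, rfl⟩, by simp [h3]⟩
  have := LinearEquiv.finrank_map_eq ψ.toLinearEquiv (LinearMap.range (LinearMap.mulLeft ℂ
      (Pi.single i 1 : ∀ i, Matrix (Fin (d i)) (Fin (d i)) ℂ)))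
  have h4 := (congrArg (fun S : Submodule ℂ _ => finrank ℂ S) hm).symm.trans this
  simp only [hr] at h4
  exact Nat.pow_left_injective two_ne_zero h4

theorem Pi.exists_trace_map_single_one {V : Type} [AddCommGroup V] [Module ℂ V]
    [FiniteDimensional ℂ V] [∀ i, NeZero (d i)]
    (f : (∀ i, Matrix (Fin (d i)) (Fin (d i)) ℂ) →ₐ[ℂ] Module.End ℂ V) (i : Fin t) :
    ∃ k : ℕ, LinearMap.trace ℂ V (f (Pi.single i 1)) = d i * k := by
  have hmul : ∀ a b c : Fin (d i), f (Pi.single i (Matrix.single a b 1)) *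
      f (Pi.single i (Matrix.single b c 1)) = f (Pi.single i (Matrix.single a c 1)) := by
    intro a b c
    rw [← map_mul, ← Pi.single_mul, Matrix.single_mul_single_same, mul_one]
  have hid : IsIdempotentElem (f (Pi.single i (Matrix.single 0 0 1))) := hmul 0 0 0
  refine ⟨finrank ℂ (LinearMap.range (f (Pi.single i (Matrix.single 0 0 1)))), ?_⟩
  rw [← (LinearMap.IsIdempotentElem.isProj_range _ hid).trace]
  have h1 : (Pi.single i 1 : ∀ i, Matrix (Fin (d i)) (Fin (d i)) ℂ) =
      ∑ a, Pi.single i (Matrix.single a a 1) := by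
    rw [← Matrix.sum_single_one]
    exact map_sum (LinearMap.single ℂ (fun i => Matrix (Fin (d i)) (Fin (d i)) ℂ) i) _ _
  rw [h1, map_sum, map_sum, Finset.sum_congr rfl (g := fun _ =>
    LinearMap.trace ℂ V (f (Pi.single i (Matrix.single 0 0 1))))]
  · simp
  · intro a _
    rw [← hmul a 0 a, LinearMap.trace_mul_comm, hmul]

end PiMatrix

namespace Representation

variable {G : Type} [Group G]

/-- If conjugation by an irreducible representation preserves a semisimple subalgebra of its
endomorphism algebra, then the simple factors of the subalgebra have the same degree `n`, and
the dimension is a multiple of `n` times their number. -/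
theorem exists_finrank_eq_mul_of_conj {V : Type} [AddCommGroup V] [Module ℂ V]
    [FiniteDimensional ℂ V] (ρ : Representation ℂ G V) [hρ : ρ.IsIrreducible]
    {t : ℕ} {d : Fin t → ℕ} [∀ i, NeZero (d i)]
    (f : (∀ i, Matrix (Fin (d i)) (Fin (d i)) ℂ) →ₐ[ℂ] Module.End ℂ V)
    (hf : Function.Injective f)
    (hconj : ∀ g, ∃ ψ : (∀ i, Matrix (Fin (d i)) (Fin (d i)) ℂ) ≃ₐ[ℂ]
      ∀ i, Matrix (Fin (d i)) (Fin (d i)) ℂ, ∀ b, f (ψ b) = ρ g * f b * ρ g⁻¹) :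
    ∃ n k : ℕ, 0 < t ∧ (∀ i, d i = n) ∧ finrank ℂ V = t * (n * k) := by
  have hinv : ∀ g, ρ g⁻¹ * ρ g = 1 := fun g => by rw [← map_mul]; simp
  have hV : Nontrivial V := by
    by_contra hV
    rw [not_nontrivial_iff_subsingleton] at hV
    exact bot_ne_top (α := Subrepresentation ρ)
      (Subrepresentation.toSubmodule_injective (Subsingleton.elim _ _))
  have ht : 0 < t := by
    by_contra! h0
    obtain rfl : t = 0 := by omega
    have h1 : f 1 = f 0 := congrArg f (Subsingleton.elim _ _)
    rw [map_one, map_zero] at h1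
    exact one_ne_zero h1
  let i₀ : Fin t := ⟨0, ht⟩
  obtain ⟨k, hk⟩ := Pi.exists_trace_map_single_one f i₀
  let ε : Fin t → ∀ i, Matrix (Fin (d i)) (Fin (d i)) ℂ := fun i => Pi.single i 1
  let S : Finset (Fin t) := Finset.univ.filter fun j =>
    d j = d i₀ ∧ LinearMap.trace ℂ V (f (ε j)) = LinearMap.trace ℂ V (f (ε i₀))
  have hs : ∀ j, (∑ i ∈ S, ε i) j = if j ∈ S then 1 else 0 := by
    intro j
    rw [Finset.sum_apply]
    simp only [ε]
    by_cases hj : j ∈ S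
    · rw [if_pos hj, Finset.sum_eq_single j]
      · simp
      · intro i _ hij
        rw [Pi.single_eq_of_ne hij.symm]
      · exact fun h => absurd hj h
    · rw [if_neg hj]
      refine Finset.sum_eq_zero fun i hi => Pi.single_eq_of_ne ?_ _
      rintro rfl
      exact hj hi
  have hss : (∑ i ∈ S, ε i) * (∑ i ∈ S, ε i) = ∑ i ∈ S, ε i := by
    funext j
    rw [Pi.mul_apply, hs]
    split_ifs <;> simp
  have hcomm : ∀ g, ρ g * f (∑ i ∈ S, ε i) = f (∑ i ∈ S, ε i) * ρ g := by
    intro g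
    obtain ⟨ψ, hψ⟩ := hconj g
    have htr : ∀ b, LinearMap.trace ℂ V (f (ψ b)) = LinearMap.trace ℂ V (f b) := by
      intro b
      rw [hψ, LinearMap.trace_mul_comm, ← mul_assoc, hinv, one_mul]
    choose π hπ hd using fun i => Pi.exists_map_single_one_eq ψ i
    have hπinj : Function.Injective π := by
      intro i j hij
      have h1 : ψ (ε i) = ψ (ε j) := by rw [hπ, hπ, hij]
      have h2 := congrFun (ψ.injective h1) i
      by_contra hne
      simp only [ε] at h2
      rw [Pi.single_eq_same, Pi.single_eq_of_ne hne] at h2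
      exact one_ne_zero h2
    have hsum : ψ (∑ i ∈ S, ε i) = ∑ i ∈ S, ε i := by
      rw [map_sum]
      refine Finset.sum_equiv (Equiv.ofBijective π (Finite.injective_iff_bijective.1 hπinj))
        (fun i => ?_) fun i _ => hπ i
      simp only [S, Finset.mem_filter, Finset.mem_univ, true_and, Equiv.ofBijective_apply, hd]
      rw [← htr (ε i)]
      simp only [ε, hπ]
    have := hψ (∑ i ∈ S, ε i)
    rw [hsum] at this
    conv_rhs => rw [this]
    rw [mul_assoc, hinv, mul_one]
  have hS : ∀ j, j ∈ S := by
    let q : Subrepresentation ρ :=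
      { toSubmodule := LinearMap.ker (f (∑ i ∈ S, ε i) - 1)
        apply_mem_toSubmodule := fun g v hv => by
          simp only [LinearMap.mem_ker, LinearMap.sub_apply, Module.End.one_apply,
            sub_eq_zero] at hv ⊢
          rw [← Module.End.mul_apply, ← hcomm, Module.End.mul_apply, hv] }
    have hi₀ : i₀ ∈ S := by simp [S]
    have hne : f (∑ i ∈ S, ε i) ≠ 0 := by
      rw [map_ne_zero_iff f hf]
      intro h0
      have := congrFun h0 i₀
      rw [hs, if_pos hi₀] at this
      exact one_ne_zero this
    have hq : q = ⊤ := by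
      refine (eq_bot_or_eq_top q).resolve_left fun hbot => hne ?_
      ext v
      have hv : f (∑ i ∈ S, ε i) v ∈ q.toSubmodule := by
        simp only [q, LinearMap.mem_ker, LinearMap.sub_apply, Module.End.one_apply, sub_eq_zero]
        rw [← Module.End.mul_apply, ← map_mul, hss]
      rw [hbot] at hv
      exact (Submodule.mem_bot ℂ).1 hv
    have h1 : f (∑ i ∈ S, ε i) = f 1 := by
      rw [map_one, ← sub_eq_zero]
      exact LinearMap.ker_eq_top.1 (congrArg Subrepresentation.toSubmodule hq)
    intro j
    by_contra hj
    have := congrFun (hf h1) j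
    rw [hs, if_neg hj] at this
    exact zero_ne_one this
  have hS' : ∀ j, d j = d i₀ ∧
      LinearMap.trace ℂ V (f (ε j)) = LinearMap.trace ℂ V (f (ε i₀)) := fun j => by
    simpa [S] using hS j
  refine ⟨d i₀, k, ht, fun j => (hS' j).1, ?_⟩
  have h1 : (1 : ∀ i, Matrix (Fin (d i)) (Fin (d i)) ℂ) = ∑ i, ε i :=
    (Finset.univ_sum_single (1 : ∀ i, Matrix (Fin (d i)) (Fin (d i)) ℂ)).symm
  have h2 := LinearMap.trace_one ℂ V
  rw [← map_one f, h1, map_sum, map_sum, Finset.sum_congr rfl (fun j _ => (hS' j).2)] at h2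
  simp only [ε, hk] at h2
  simp only [Finset.sum_const, Finset.card_univ, Fintype.card_fin, nsmul_eq_mul] at h2
  exact_mod_cast h2.symm

end Representation

namespace Representation

variable {G : Type} [Group G]

/-- If all irreducible representations that are nontrivial on the normal subgroup `N` have the
same dimension, then the elements of `N` commute in every irreducible representation. -/
theorem commute_of_irreducible [Finite G] {N : Subgroup G} [hN : N.Normal] {m : ℕ}
    (H : ∀ {V : Type} [AddCommGroup V] [Module ℂ V] [FiniteDimensional ℂ V]
      (ρ : Representation ℂ G V), ρ.IsIrreducible → (∃ n ∈ N, ρ n ≠ 1) → finrank ℂ V = m)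
    {V : Type} [AddCommGroup V] [Module ℂ V] [FiniteDimensional ℂ V]
    (ρ : Representation ℂ G V) (hρ : ρ.IsIrreducible) {a b : G} (ha : a ∈ N) (hb : b ∈ N) :
    ρ a * ρ b = ρ b * ρ a := by
  by_cases htriv : ∃ n ∈ N, ρ n ≠ 1
  swap
  · push Not at htriv
    rw [htriv a ha, htriv b hb]
  have hm := H ρ hρ htriv
  let τ : Representation ℂ N V := ρ.comp N.subtype
  let A : Subalgebra ℂ (Module.End ℂ V) := (asAlgebraHom τ).range
  have hA : ∀ n ∈ N, ρ n ∈ A := fun n hn =>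
    ⟨MonoidAlgebra.single ⟨n, hn⟩ 1, by simp [τ, asAlgebraHom_single]⟩
  have hAind : ∀ W : Submodule ℂ (Module.End ℂ V), (∀ n ∈ N, ρ n ∈ W) → ∀ x ∈ A, x ∈ W := by
    rintro W hW _ ⟨y, rfl⟩
    change asAlgebraHom τ y ∈ W
    induction y using MonoidAlgebra.induction_linear with
    | zero => rw [map_zero]; exact W.zero_mem
    | add x y hx hy => rw [map_add]; exact W.add_mem hx hy
    | single n c =>
      rw [asAlgebraHom_single]
      exact W.smul_mem c (hW n n.2)
  have hinv : ∀ g, ρ g⁻¹ * ρ g = 1 := fun g => by rw [← map_mul]; simp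
  have hinv' : ∀ g, ρ g * ρ g⁻¹ = 1 := fun g => by rw [← map_mul]; simp
  let U : Subrepresentation (linHom ρ ρ) :=
    { toSubmodule := Subalgebra.toSubmodule A
      apply_mem_toSubmodule := fun g x hx => by
        refine hAind ((Subalgebra.toSubmodule A).comap (linHom ρ ρ g)) (fun n hn => ?_) x hx
        rw [Submodule.mem_comap, linHom_apply]
        have : ρ g ∘ₗ ρ n ∘ₗ ρ g⁻¹ = ρ (g * n * g⁻¹) := by
          rw [map_mul, map_mul]; rfl
        rw [this]
        exact hA _ (hN.conj_mem n hn g) }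
  have hU : ∀ g, ∀ x ∈ A, ρ g * x * ρ g⁻¹ ∈ A := fun g x hx =>
    U.apply_mem_toSubmodule g hx
  have : IsSemisimpleRing A :=
    RingHom.isSemisimpleRing_of_surjective (asAlgebraHom τ).rangeRestrict.toRingHom
      (asAlgebraHom τ).rangeRestrict_surjective
  obtain ⟨t, d, hd, ⟨e⟩⟩ := IsSemisimpleRing.exists_algEquiv_pi_matrix_of_isAlgClosed ℂ A
  let c : G → A →ₐ[ℂ] A := fun g =>
    { toFun := fun x => ⟨ρ g * x * ρ g⁻¹, hU g x x.2⟩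
      map_one' := Subtype.ext (by simp [hinv'])
      map_mul' := fun x y => Subtype.ext (by
        simp only [MulMemClass.coe_mul]
        calc ρ g * (x * y) * ρ g⁻¹ = ρ g * x * 1 * y * ρ g⁻¹ := by
              simp only [mul_assoc, mul_one]
          _ = _ := by rw [← hinv g]; simp only [mul_assoc])
      map_zero' := Subtype.ext (by simp)
      map_add' := fun x y => Subtype.ext (by simp [mul_add, add_mul])
      commutes' := fun r => Subtype.ext (by
        simp [Algebra.algebraMap_eq_smul_one, hinv']) }
  have hc : ∀ g h : G, g * h = 1 → (c g).comp (c h) = AlgHom.id ℂ A := by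
    intro g h hgh
    obtain rfl := inv_eq_of_mul_eq_one_right hgh
    ext x : 2
    change ρ g * (ρ g⁻¹ * x * ρ g⁻¹⁻¹) * ρ g⁻¹ = x
    rw [inv_inv, ← mul_assoc, ← mul_assoc, hinv', one_mul, mul_assoc, hinv', mul_one]
  obtain ⟨n, k, ht, hdn, hk⟩ := exists_finrank_eq_mul_of_conj ρ
    (A.val.comp e.symm.toAlgHom) (Subtype.val_injective.comp e.symm.injective)
    (fun g => ⟨e.symm.trans ((AlgEquiv.ofAlgHom (c g) (c g⁻¹) (hc _ _ (mul_inv_cancel g))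
      (hc _ _ (inv_mul_cancel g))).trans e), fun b => by simp [c]⟩)
  have hcenter : (Subalgebra.toSubmodule (Subalgebra.center ℂ A)).map e.toLinearEquiv.toLinearMap =
      Subalgebra.toSubmodule (Subalgebra.center ℂ _) := by
    ext x
    simp only [Submodule.mem_map, Subalgebra.mem_toSubmodule, Subalgebra.mem_center_iff]
    constructor
    · rintro ⟨y, hy, rfl⟩ z
      obtain ⟨z, rfl⟩ := e.surjective z
      simpa using congrArg e (hy z)
    · intro hx
      exact ⟨e.symm x, fun z => e.injective (by simpa using hx (e z)), by simp⟩
  have hcfin : finrank ℂ (Subalgebra.center ℂ A) = t := by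
    rw [← Pi.finrank_matrix_center (d := d), ← Subalgebra.finrank_toSubmodule,
      ← Subalgebra.finrank_toSubmodule, ← hcenter]
    exact (LinearEquiv.finrank_map_eq e.toLinearEquiv _).symm
  have hAfin : finrank ℂ A = t * n ^ 2 := by
    rw [e.toLinearEquiv.finrank_eq, Module.finrank_pi_fintype]
    simp [finrank_matrix, hdn, sq]
  obtain ⟨l, hl⟩ := exists_finrank_eq_finrank_fixedBy_add H U.toRepresentation
  have hfix : finrank ℂ (U.toRepresentation.fixedBy N).toSubmodule = t := by
    rw [← hcfin, ← Subalgebra.finrank_toSubmodule]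
    suffices hmap :
        (U.toRepresentation.fixedBy N).toSubmodule.map (Subalgebra.toSubmodule A).subtype =
        (Subalgebra.toSubmodule (Subalgebra.center ℂ A)).map A.val.toLinearMap by
      refine (Submodule.finrank_map_subtype_eq _ _).symm.trans ?_
      rw [hmap]
      exact Submodule.finrank_map_subtype_eq (Subalgebra.toSubmodule A)
        (Subalgebra.toSubmodule (Subalgebra.center ℂ A))
    ext x
    simp only [Submodule.mem_map]
    constructor
    · rintro ⟨x, hx, rfl⟩
      refine ⟨x, ?_, rfl⟩
      have hx' : ∀ n ∈ N, ρ n * x * ρ n⁻¹ = x := fun n hn => congrArg Subtype.val (hx n hn)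
      refine (Subalgebra.mem_center_iff (R := ℂ)).2 fun y => Subtype.ext ?_
      refine hAind (LinearMap.eqLocus (LinearMap.mulRight ℂ x.1) (LinearMap.mulLeft ℂ x.1))
        (fun n hn => ?_) y.1 y.2
      change ρ n * x = x * ρ n
      conv_rhs => rw [← hx' n hn]
      rw [mul_assoc, hinv, mul_one]
    · rintro ⟨x, hx, rfl⟩
      refine ⟨x, fun n hn => Subtype.ext ?_, rfl⟩
      change ρ n * x * ρ n⁻¹ = x
      have h1 : ρ n * x = x * ρ n :=
        congrArg Subtype.val ((Subalgebra.mem_center_iff (R := ℂ)).1 hx ⟨ρ n, hA n hn⟩)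
      rw [h1, mul_assoc, hinv', mul_one]
  have hn : n = 1 := by
    have h1 : t * n ^ 2 = t + t * (n * k) * l := by
      rw [← hAfin, ← hk, hm, ← hfix, ← hl]
      rfl
    have h2 : n ^ 2 = 1 + n * k * l := Nat.eq_of_mul_eq_mul_left ht (by rw [h1]; ring)
    have h3 : n ∣ 1 := (Nat.dvd_add_left (Dvd.intro (k * l) (by ring))).1
      (h2 ▸ dvd_pow_self n two_ne_zero : n ∣ 1 + n * k * l)
    exact Nat.dvd_one.1 h3
  have hcomm : ∀ x y : A, x * y = y * x := by
    intro x y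
    apply e.injective
    rw [map_mul, map_mul]
    funext i
    have : Subsingleton (Fin (d i)) := by rw [hdn i, hn]; infer_instance
    ext p q
    obtain rfl := Subsingleton.elim p q
    simp only [Pi.mul_apply, Matrix.mul_apply]
    exact Finset.sum_congr rfl fun r _ => by
      obtain rfl := Subsingleton.elim p r
      exact mul_comm _ _
  exact congrArg Subtype.val (hcomm ⟨ρ a, hA a ha⟩ ⟨ρ b, hA b hb⟩)

/-- Irreducible representations separate the elements of a finite group. -/
theorem eq_of_forall_irreducible [Finite G] {a b : G}
    (h : ∀ {V : Type} [AddCommGroup V] [Module ℂ V] [FiniteDimensional ℂ V]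
      (ρ : Representation ℂ G V), ρ.IsIrreducible → ρ a = ρ b) : a = b := by
  have key : ∀ {V : Type} [AddCommGroup V] [Module ℂ V] [FiniteDimensional ℂ V]
      (ρ : Representation ℂ G V), ρ a = ρ b := by
    intro V _ _ _ ρ
    induction ρ using induction_on_irreducible with
    | zero ρ => exact Subsingleton.elim _ _
    | irreducible ρ hρ => exact h ρ hρ
    | @compl V _ _ _ ρ p q hpq hp hq =>
      ext v
      have hv : v ∈ (p ⊔ q).toSubmodule := by
        rw [hpq.sup_eq_top]; exact Submodule.mem_top
      obtain ⟨x, hx, y, hy, rfl⟩ := Submodule.mem_sup.1 hv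
      have h1 : ρ a x = ρ b x := congrArg Subtype.val (LinearMap.congr_fun hp ⟨x, hx⟩)
      have h2 : ρ a y = ρ b y := congrArg Subtype.val (LinearMap.congr_fun hq ⟨y, hy⟩)
      rw [map_add, map_add, h1, h2]
  have h1 := LinearMap.congr_fun (key (ofMulAction ℂ G G)) (MonoidAlgebra.single 1 1)
  rw [ofMulAction_single, ofMulAction_single, smul_eq_mul, smul_eq_mul, mul_one, mul_one] at h1
  exact MonoidAlgebra.single_left_injective one_ne_zero h1

theorem simple_fdRep_of [Finite G] {V : Type} [AddCommGroup V] [Module ℂ V] [FiniteDimensional ℂ V]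
    (ρ : Representation ℂ G V) [ρ.IsIrreducible] : Simple (FDRep.of ρ) := by
  have := Fintype.ofFinite G
  have : Invertible (Nat.card G : ℂ) := invertibleOfNonzero (by simp)
  rw [FDRep.simple_iff_char_is_norm_one]
  have h := char_orthonormal ρ ρ
  rw [if_pos ⟨.refl ρ⟩, inv_mul_eq_one₀ (by simp)] at h
  exact h.symm

/-- If `N` acts nontrivially then the character is not constant on `N`. -/
theorem exists_character_ne [Finite G] {N : Subgroup G} {V : Type} [AddCommGroup V] [Module ℂ V]
    [FiniteDimensional ℂ V] (ρ : Representation ℂ G V) (h : ∃ n ∈ N, ρ n ≠ 1) :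
    ¬ ∀ n ∈ N, (FDRep.of ρ).character n = (FDRep.of ρ).character 1 := by
  intro hN
  have := Fintype.ofFinite N
  have : Invertible (Nat.card N : ℂ) := invertibleOfNonzero (by simp)
  let τ : Representation ℂ N V := ρ.comp N.subtype
  have h1 := card_inv_mul_sum_char_eq_finrank τ
  have h2 : ∀ n : N, τ.character n = finrank ℂ V := fun n => by
    rw [← char_one ρ]
    exact hN n n.2
  simp only [h2, Finset.sum_const, Finset.card_univ, nsmul_eq_mul, ← Nat.card_eq_fintype_card] at h1
  rw [inv_mul_cancel_left₀ (by simp)] at h1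
  have h3 : τ.invariants = ⊤ := Submodule.eq_top_of_finrank_eq (by exact_mod_cast h1.symm)
  obtain ⟨n, hn, hne⟩ := h
  refine hne (LinearMap.ext fun v => ?_)
  have hv : v ∈ τ.invariants := h3 ▸ Submodule.mem_top
  exact hv ⟨n, hn⟩

end Representation

/-- An irreducible representation is spanned by an orbit, so its dimension is at most the order
of the group. -/
theorem FDRep.finrank_le_card_of_simple {G : Type} [Group G] [Finite G] (V : FDRep ℂ G) [Simple V] :
    finrank ℂ V ≤ Nat.card G := by
  have := Fintype.ofFinite G
  rcases subsingleton_or_nontrivial V with hV | hV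
  · simp [finrank_zero_of_subsingleton]
  obtain ⟨w, hw⟩ := exists_ne (0 : V)
  obtain ⟨φ, hφ⟩ : ∃ φ : Module.Dual ℂ V, φ w ≠ 0 := by
    by_contra! h
    exact hw ((Module.forall_dual_apply_eq_zero_iff ℂ w).1 h)
  have hend : finrank ℂ (Representation.linHom V.ρ V.ρ).invariants = 1 := by
    rw [(Representation.linHom.invariantsEquivFDRepHom V V).finrank_eq]
    exact finrank_endomorphism_simple_eq_one ℂ V
  let f : V →ₗ[ℂ] V := ∑ g : G, Representation.linHom V.ρ V.ρ g (φ.smulRight w)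
  have hf : f ∈ (Representation.linHom V.ρ V.ρ).invariants := by
    intro h
    rw [map_sum]
    refine Fintype.sum_equiv (Equiv.mulLeft h) _ _ fun g => ?_
    rw [← Module.End.mul_apply, ← map_mul]
    rfl
  have htr : LinearMap.trace ℂ V f = Nat.card G * φ w := by
    have : ∀ g : G, LinearMap.trace ℂ V (Representation.linHom V.ρ V.ρ g (φ.smulRight w)) = φ w := by
      intro g
      rw [Representation.linHom_apply, LinearMap.trace_comp_comm', LinearMap.comp_assoc,
        ← Module.End.mul_eq_comp (V.ρ g⁻¹), ← map_mul, inv_mul_cancel, map_one,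
        Module.End.one_eq_id, LinearMap.comp_id, LinearMap.trace_smulRight]
    rw [map_sum, Finset.sum_congr rfl fun g _ => this g]
    simp
  have hf0 : f ≠ 0 := by
    intro h0
    rw [h0, map_zero] at htr
    exact mul_ne_zero (by simp) hφ htr.symm
  have hid : LinearMap.id ∈ (Representation.linHom V.ρ V.ρ).invariants := by
    intro g
    rw [Representation.linHom_apply, LinearMap.id_comp, ← Module.End.mul_eq_comp, ← map_mul,
      mul_inv_cancel, map_one, Module.End.one_eq_id]
  obtain ⟨c, hc⟩ := (finrank_eq_one_iff_of_nonzero'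
    (⟨f, hf⟩ : (Representation.linHom V.ρ V.ρ).invariants)
    (fun h => hf0 (congrArg Subtype.val h))).1 hend ⟨LinearMap.id, hid⟩
  have hc' : c • f = LinearMap.id := congrArg Subtype.val hc
  have hspan : Submodule.span ℂ (Set.range fun g => V.ρ g w) = ⊤ := by
    refine eq_top_iff.2 fun v _ => ?_
    rw [← LinearMap.id_apply (R := ℂ) v, ← hc', LinearMap.smul_apply, LinearMap.sum_apply]
    refine Submodule.smul_mem _ _ (Submodule.sum_mem _ fun g _ => ?_)
    rw [Representation.linHom_apply]
    simp only [LinearMap.comp_apply, LinearMap.smulRight_apply, map_smul]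
    exact Submodule.smul_mem _ _ (Submodule.subset_span ⟨g, rfl⟩)
  rw [← finrank_top, ← hspan, Nat.card_eq_fintype_card]
  exact finrank_range_le_card _

theorem cdOver_finite {G : Type} [Group G] [Finite G] (N : Subgroup G) : (cdOver G N).Finite := by
  refine (Set.finite_Iic (Nat.card G)).subset ?_
  rintro _ ⟨V, hV, -, rfl⟩
  exact V.finrank_le_card_of_simple

theorem finrank_mem_cdOver {G : Type} [Group G] [Finite G] {N : Subgroup G} {V : Type}
    [AddCommGroup V] [Module ℂ V] [FiniteDimensional ℂ V] (ρ : Representation ℂ G V)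
    (hρ : ρ.IsIrreducible) (h : ∃ n ∈ N, ρ n ≠ 1) : finrank ℂ V ∈ cdOver G N :=
  ⟨FDRep.of ρ, ρ.simple_fdRep_of, ρ.exists_character_ne h, rfl⟩

theorem eq_bot_of_cdOver_eq_empty {G : Type} [Group G] [Finite G] {N : Subgroup G}
    (h : cdOver G N = ∅) : N = ⊥ := by
  refine (Subgroup.eq_bot_iff_forall N).2 fun n hn =>
    Representation.eq_of_forall_irreducible fun ρ hρ => ?_
  by_contra hne
  rw [map_one] at hne
  exact h.le (finrank_mem_cdOver ρ hρ ⟨n, hn, hne⟩)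

theorem mul_comm_of_cdOver_subsingleton {G : Type} [Group G] [Finite G] {N : Subgroup G}
    [N.Normal] (h : (cdOver G N).Subsingleton) {a b : G} (ha : a ∈ N) (hb : b ∈ N) :
    a * b = b * a := by
  obtain ⟨m, hm⟩ : ∃ m, ∀ d ∈ cdOver G N, d = m := by
    rcases h.eq_empty_or_singleton with h0 | ⟨m, hm⟩
    · exact ⟨0, by simp [h0]⟩
    · exact ⟨m, by simp [hm]⟩
  refine Representation.eq_of_forall_irreducible fun ρ hρ => ?_
  rw [map_mul, map_mul]
  exact Representation.commute_of_irreducible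
    (fun ρ hρ h => hm _ (finrank_mem_cdOver ρ hρ h)) ρ hρ ha hb

end

/-- **Corollary 3.2.** If `N ⊴ G` and `|cd(G|N)| ≤ 1`, then the derived length of `N`
is at most `|cd(G|N)|`; in particular `N` is abelian. -/
theorem stmt2 (G : Type) [Group G] [Fintype G] (N : Subgroup G) [N.Normal]
    (h : (cdOver G N).ncard ≤ 1) :
    derivedSeries ↥N ((cdOver G N).ncard) = ⊥ ∧ ∀ a b : ↥N, a * b = b * a := by
  have hfin := cdOver_finite N
  have hcomm : ∀ a b : ↥N, a * b = b * a := fun a b => Subtype.ext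
    (mul_comm_of_cdOver_subsingleton ((Set.ncard_le_one hfin).1 h) a.2 b.2)
  refine ⟨?_, hcomm⟩
  rcases Nat.le_one_iff_eq_zero_or_eq_one.1 h with h0 | h1
  · obtain rfl := eq_bot_of_cdOver_eq_empty ((Set.ncard_eq_zero hfin).1 h0)
    exact Subgroup.eq_bot_of_subsingleton _
  · rw [h1, derivedSeries_one, commutator_eq_bot_iff]
    exact ⟨⟨hcomm⟩⟩
end

section
/- Let G be a finite group, χ ∈ Irr(G), and let V = V(χ) be the vanishing-off subgroup of χ, namely the subgroup of G generated by all elements x ∈ G with χ(x) ≠ 0. If K is a normal subgroup of G and K ∩ V ⊆ ker χ, then K ⊆ ker χ. -/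
open CategoryTheory

namespace FDRep

universe u v

variable {k : Type u} [Field k]

/-- Schur's lemma for linear maps: a nonzero linear map commuting with a simple representation is
bijective. -/
theorem bijective_of_commute_of_ne_zero {G : Type v} [Monoid G] (V : FDRep k G) [Simple V]
    (f : V →ₗ[k] V) (hf : ∀ g, Commute f (V.ρ g)) (h0 : f ≠ 0) : Function.Bijective f := by
  let F : V ⟶ V := ⟨InducedCategory.homMk (ModuleCat.ofHom f), fun g => by
    ext x
    exact LinearMap.congr_fun (hf g).eq x⟩
  have hF : F ≠ 0 := fun h => h0 (congrArg (fun φ : V ⟶ V => φ.hom.hom.hom) h)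
  have : IsIso F := isIso_of_hom_simple hF
  exact (isoToLinearEquiv (asIso F)).bijective

variable {G : Type v} [Group G] [Fintype G] (V : FDRep k G) (K : Subgroup G)

open scoped Classical in
/-- The sum of the operators by which the elements of a subgroup act. -/
noncomputable def subgroupSum : V →ₗ[k] V := ∑ x : K, V.ρ x

theorem ρ_mul_subgroupSum (x : K) : V.ρ x * V.subgroupSum K = V.subgroupSum K := by
  classical
  rw [subgroupSum, Finset.mul_sum]
  refine Fintype.sum_equiv (Equiv.mulLeft x) _ _ fun y => ?_
  simp

theorem commute_subgroupSum [K.Normal] (g : G) : Commute (V.subgroupSum K) (V.ρ g) := by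
  classical
  rw [commute_iff_eq, subgroupSum, Finset.sum_mul, Finset.mul_sum, eq_comm]
  refine Fintype.sum_equiv (MulAut.conjNormal (H := K) g).toEquiv _ _ fun y => ?_
  simp [← map_mul]

open scoped Classical in
theorem trace_subgroupSum :
    LinearMap.trace k V (V.subgroupSum K) = ∑ x : K, V.character x := by
  simp [subgroupSum, character]

/-- A normal subgroup over which the character of a simple representation has nonzero sum acts
trivially. -/
theorem ρ_eq_one_of_sum_character_ne_zero [Simple V] [K.Normal]
    (h : ∑ᶠ x : K, V.character x ≠ 0) (x : G) (hx : x ∈ K) : V.ρ x = 1 := by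
  classical
  rw [finsum_eq_sum_of_fintype, ← trace_subgroupSum] at h
  have hP := V.bijective_of_commute_of_ne_zero _ (V.commute_subgroupSum K)
    fun h0 => h (by rw [h0, map_zero])
  ext v
  obtain ⟨w, rfl⟩ := hP.surjective v
  exact LinearMap.congr_fun (V.ρ_mul_subgroupSum K ⟨x, hx⟩) w

end FDRep

/-- **Lemma 4.2.** Let `χ ∈ Irr(G)` (formalized by a simple `V : FDRep ℂ G`) and let
`V(χ)` be the vanishing-off subgroup of `χ`, the subgroup generated by all `x ∈ G` with
`χ(x) ≠ 0`.  If `K ⊴ G` and `K ∩ V(χ) ⊆ ker χ = {g : χ(g) = χ(1)}`, then `K ⊆ ker χ`. -/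
theorem stmt5 (G : Type) [Group G] [Fintype G]
    (V : FDRep ℂ G) (hV : Simple V)
    (K : Subgroup G) (hK : K.Normal)
    (h : ∀ g ∈ K ⊓ Subgroup.closure {x : G | V.character x ≠ 0},
      V.character g = V.character 1) :
    ∀ k ∈ K, V.character k = V.character 1 := by
  classical
  intro k hk
  by_cases h1 : V.character 1 = 0
  · rw [FDRep.char_one, Nat.cast_eq_zero, Module.finrank_zero_iff] at h1
    rw [FDRep.character, Subsingleton.elim (V.ρ k) (V.ρ 1), ← FDRep.character]
  suffices hsum : ∑ᶠ x : K, V.character x ≠ 0 by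
    simp only [FDRep.character, V.ρ_eq_one_of_sum_character_ne_zero K hsum k hk, map_one]
  have hval (x : K) : V.character x = if V.character x ≠ 0 then V.character 1 else 0 := by
    split_ifs with hx
    · exact h x ⟨x.2, Subgroup.subset_closure hx⟩
    · exact not_not.mp hx
  rw [finsum_eq_sum_of_fintype, Finset.sum_congr rfl fun x _ => hval x, ← Finset.sum_filter,
    Finset.sum_const, nsmul_eq_mul]
  refine mul_ne_zero (Nat.cast_ne_zero.mpr (Finset.card_ne_zero.mpr ⟨1, ?_⟩)) h1
  simpa using h1
end
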